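/- arXiv:2412.19090 — 3 statements merged into one kernel-verified Lean document; each statement's English description precedes it below -/
import Mathlib

section
/- Define f : (0,1) → ℝ by f(x) = x·ln(x) − x·ln(1−x) + ln(x)·ln(1−x). Then f(x) > 0 for all x ∈ (0,1). -/
/-- The function `f(x) = x·ln x − x·ln(1−x) + ln x · ln(1−x)` is strictly
positive on `(0, 1)`. -/
theorem f_pos (x : ℝ) (hx0 : 0 < x) (hx1 : x < 1) :
    0 < x * Real.log x - x * Real.log (1 - x) + Real.log x * Real.log (1 - x) := by
  have ha : Real.log x < 0 := Real.log_neg hx0 hx1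
  have hb : Real.log (1 - x) ≤ (1 - x) - 1 := Real.log_le_sub_one_of_pos (by linarith)
  have h1 : 0 ≤ (-Real.log x) * (-Real.log (1 - x) - x) :=
    mul_nonneg (by linarith) (by linarith)
  have h2 : 0 < x * (-Real.log (1 - x)) := mul_pos hx0 (by linarith)
  nlinarith [h1, h2]
end

section
/- For every real x with 0 < x < 1, one has ln(x)/ln(1−x) < (1/x)·ln(1/x) + 1. -/
/-- For `0 < x < 1`, `ln x / ln(1−x) < (1/x)·ln(1/x) + 1`. -/
theorem log_div_log_lt (x : ℝ) (hx0 : 0 < x) (hx1 : x < 1) :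
    Real.log x / Real.log (1 - x) < (1 / x) * Real.log (1 / x) + 1 := by
  have hL : Real.log x < 0 := Real.log_neg hx0 hx1
  have hM : Real.log (1 - x) ≤ -x := by
    have := Real.log_le_sub_one_of_pos (show 0 < 1 - x by linarith)
    linarith
  have h : (-Real.log x) / (-Real.log (1 - x)) ≤ (-Real.log x) / x :=
    div_le_div_of_nonneg_left (by linarith) hx0 (by linarith)
  rw [neg_div_neg_eq] at h
  have e : (1 / x) * Real.log (1 / x) = (-Real.log x) / x := by
    rw [one_div, Real.log_inv]; ring
  rw [e]
  linarith
end

section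
/- Define g : (0,1) → ℝ by g(x) = ln(1−x) + x·(1 − 2x + x·ln(x))/(x − 1)². Then g(x) < 0 for all x ∈ (0,1). -/
/-- The function `g(x) = ln(1−x) + x·(1 − 2x + x·ln x)/(x−1)²` is strictly
negative on `(0, 1)`. -/
theorem g_neg (x : ℝ) (hx0 : 0 < x) (hx1 : x < 1) :
    Real.log (1 - x) + x * (1 - 2 * x + x * Real.log x) / (x - 1) ^ 2 < 0 := by
  have h1 : Real.log (1 - x) ≤ -x := by
    have := Real.log_le_sub_one_of_pos (show 0 < 1 - x by linarith)
    linarith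
  have h2 : Real.log x < 0 := Real.log_neg hx0 hx1
  have hp : 0 < (x - 1) ^ 2 := sq_pos_of_neg (by linarith)
  have h3 : x * (1 - 2 * x + x * Real.log x) / (x - 1) ^ 2 < x := by
    rw [div_lt_iff₀ hp]
    have h4 : x ^ 2 * Real.log x < 0 := mul_neg_of_pos_of_neg (by positivity) h2
    have h5 : 0 < x ^ 3 := by positivity
    nlinarith
  linarith
end
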